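/- Let g be a complex simple Lie algebra graded by ad h as g = ⊕_{j∈½ℤ} g_j for an sl₂-triple {e,h,f}, and let χ = (f|·). Let I_{>0,χ} be the two-sided ideal of U(g_{>0}) generated by x − χ(x) for x ∈ g_{≥1}. Then D := U(g_{>0})/I_{>0,χ} is isomorphic to the Weyl algebra of rank (dim g_{1/2})/2; in particular, the images φ_i of a basis x_i of g_{1/2} satisfy [φ_i, φ_j] = χ([x_i, x_j]). -/

import Mathlib

/-- The `ad h`-eigenspace `g_j` (eigenvalue `2j`). -/
noncomputable def gwt {L : Type*} [LieRing L] [LieAlgebra ℂ L] (h : L) (j : ℚ) :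
    Submodule ℂ L :=
  Module.End.eigenspace (LieAlgebra.ad ℂ L h) ((2 * j : ℚ) : ℂ)

/-- Defining relations of the Weyl algebra of rank `n`:
`[p_i, q_j] = δ_{ij}`, `[p_i, p_j] = [q_i, q_j] = 0`. -/
inductive WeylRel (n : ℕ) :
    FreeAlgebra ℂ (Fin n ⊕ Fin n) → FreeAlgebra ℂ (Fin n ⊕ Fin n) → Prop
  | pq (i j : Fin n) : WeylRel n
      (FreeAlgebra.ι ℂ (Sum.inl i) * FreeAlgebra.ι ℂ (Sum.inr j)
        - FreeAlgebra.ι ℂ (Sum.inr j) * FreeAlgebra.ι ℂ (Sum.inl i))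
      (if i = j then 1 else 0)
  | pp (i j : Fin n) : WeylRel n
      (FreeAlgebra.ι ℂ (Sum.inl i) * FreeAlgebra.ι ℂ (Sum.inl j))
      (FreeAlgebra.ι ℂ (Sum.inl j) * FreeAlgebra.ι ℂ (Sum.inl i))
  | qq (i j : Fin n) : WeylRel n
      (FreeAlgebra.ι ℂ (Sum.inr i) * FreeAlgebra.ι ℂ (Sum.inr j))
      (FreeAlgebra.ι ℂ (Sum.inr j) * FreeAlgebra.ι ℂ (Sum.inr i))

/-- The Weyl algebra of rank `n` over `ℂ`. -/
noncomputable abbrev WeylAlgebra (n : ℕ) := RingQuot (WeylRel n)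

open Polynomial in
/-- Polynomials `(A, B)` in the shifted Casimir `Ω` describing the action of `4ᵏ FᵏEᵏ` on a generalized
weight vector of weight `1`. -/
noncomputable def casimirPoly : ℕ → ℂ[X] × ℂ[X]
  | 0 => (1, 0)
  | k + 1 => ((casimirPoly k).1 * (X - C ((2 * (k : ℂ) + 2) ^ 2)),
      (casimirPoly k).2 * (X - C ((2 * (k : ℂ) + 2) ^ 2)) + (casimirPoly k).1 * C (4 * ((k : ℂ) + 1)))

open Polynomial in
lemma isCoprime_casimirPoly_fst (k : ℕ) (a : ℂ) (ha : ∀ i < k, a ≠ (2 * (i : ℂ) + 2) ^ 2) :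
    IsCoprime (casimirPoly k).1 (X - C a) := by
  induction k with
  | zero => exact isCoprime_one_left
  | succ k ih =>
    exact (ih fun i hi ↦ ha i (by omega)).mul_left
      (isCoprime_X_sub_C_of_isUnit_sub (sub_ne_zero.2 (ha k (by omega)).symm).isUnit)

open Polynomial in
lemma IsCoprime.mul_mul_add_mul_of_isUnit (A B l c : ℂ[X]) (hAB : IsCoprime A B) (hAl : IsCoprime A l)
    (hc : IsUnit c) : IsCoprime (A * l) (B * l + A * c) := by
  refine IsCoprime.mul_left ((hAB.mul_right hAl).add_mul_left_right _) ?_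
  rw [add_comm]
  refine IsCoprime.add_mul_right_right ?_ _
  exact hAl.symm.mul_right (isCoprime_one_right.of_isCoprime_of_dvd_right hc.dvd)

open Polynomial in
lemma isCoprime_casimirPoly (k : ℕ) : IsCoprime (casimirPoly k).1 (X * (casimirPoly k).2) := by
  have hX : IsCoprime (casimirPoly k).1 X := by
    have := isCoprime_casimirPoly_fst k 0 fun i _ ↦ by
      have : (2 * (i : ℂ) + 2) ≠ 0 := by exact_mod_cast (by omega : 2 * i + 2 ≠ 0)
      exact (pow_ne_zero 2 this).symm
    simpa using this
  refine hX.mul_right ?_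
  clear hX
  induction k with
  | zero => exact isCoprime_one_left
  | succ k ih =>
    have hl : IsCoprime (casimirPoly k).1 (X - C ((2 * (k : ℂ) + 2) ^ 2)) :=
      isCoprime_casimirPoly_fst k _ fun i hi h ↦ by
        have : (2 * k + 2) ^ 2 = (2 * i + 2) ^ 2 := by exact_mod_cast h
        have := Nat.pow_left_injective (n := 2) (by norm_num) this
        omega
    have hu : IsUnit (C (4 * ((k : ℂ) + 1))) :=
      isUnit_C.2 (mul_ne_zero (by norm_num) (Nat.cast_add_one_ne_zero k)).isUnit
    exact ih.mul_mul_add_mul_of_isUnit _ _ _ _ hl hu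

section Sl2

variable {V : Type*} [AddCommGroup V] [Module ℂ V] {E F H : Module.End ℂ V}

lemma exists_pow_apply_eq_zero [FiniteDimensional ℂ V] {c : ℂ} (hc : c ≠ 0)
    (hHE : H * E = E * H + c • E) {μ : ℂ} {x : V} (hx : (H - algebraMap ℂ _ μ) ((H - algebraMap ℂ _ μ) x) = 0) :
    ∃ k₀, ∀ k ≥ k₀, (E ^ k) x = 0 := by
  have hcomm (k : ℕ) (x : V) :
      (H - algebraMap ℂ _ (μ + k * c)) ((E ^ k) x) = (E ^ k) ((H - algebraMap ℂ _ μ) x) := by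
    induction k with
    | zero => simp
    | succ k ih =>
      have h1 := congrArg (· ((E ^ k) x)) hHE
      simp only [pow_succ', Module.End.mul_apply, LinearMap.sub_apply, LinearMap.add_apply,
        LinearMap.smul_apply, Module.algebraMap_end_apply] at h1 ih ⊢
      rw [h1, ← ih]
      simp only [map_sub, map_smul]
      push_cast
      module
  have key (y : V) (hy : ∀ᶠ k in Filter.atTop, (H - algebraMap ℂ _ (μ + (k : ℕ) * c)) ((E ^ k) y) = 0) :
      ∀ᶠ k in Filter.atTop, (E ^ k) y = 0 := by
    have hinj : Function.Injective fun k : ℕ ↦ μ + k * c := fun a b hab ↦ by simpa [hc] using hab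
    have hfin := (Module.End.finite_hasEigenvalue H).preimage (f := fun k : ℕ ↦ μ + k * c) hinj.injOn
    have hev := Nat.cofinite_eq_atTop ▸ hfin.eventually_cofinite_notMem
    filter_upwards [hy, hev] with k hk hk'
    by_contra h0
    refine hk' (Module.End.hasEigenvalue_of_hasEigenvector (x := (E ^ k) y) ⟨?_, h0⟩)
    rw [Module.End.mem_eigenspace_iff]
    rwa [LinearMap.sub_apply, Module.algebraMap_end_apply, sub_eq_zero] at hk
  have h1 : ∀ᶠ k in Filter.atTop, (E ^ k) ((H - algebraMap ℂ _ μ) x) = 0 :=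
    key _ (.of_forall fun k ↦ by rw [hcomm, hx, map_zero])
  exact Filter.eventually_atTop.1 (key _ (h1.mono fun k hk ↦ by rw [hcomm, hk]))

/-- The shifted Casimir operator. -/
def shiftedCasimir (E F H : Module.End ℂ V) : Module.End ℂ V := 4 * (F * E) + (H + 1) ^ 2

variable (hHE : H * E = E * H + (2 : ℂ) • E) (hHF : H * F = F * H + (-2 : ℂ) • F)
  (hEF : E * F = F * E + H)

include hEF in
lemma shiftedCasimir_eq : shiftedCasimir E F H = 4 * (E * F) + (H - 1) ^ 2 := by
  rw [hEF, shiftedCasimir]; noncomm_ring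

include hHE in
lemma sl2_pow_mul (k : ℕ) (c : ℂ) :
    (H + algebraMap ℂ _ c) * E ^ k = E ^ k * (H + algebraMap ℂ _ (c + 2 * k)) := by
  induction k with
  | zero => simp
  | succ k ih =>
    rw [pow_succ, ← mul_assoc, ih, mul_assoc, mul_assoc, add_mul, hHE, Algebra.algebraMap_eq_smul_one,
      Algebra.algebraMap_eq_smul_one]
    congr 1
    simp only [mul_add, smul_mul_assoc, mul_smul_comm, one_mul, mul_one]
    push_cast
    module

include hHE hEF in
lemma commute_shiftedCasimir_E : Commute (shiftedCasimir E F H) E := by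
  change shiftedCasimir E F H * E = E * shiftedCasimir E F H
  have h : (H - 1) * E = E * (H + 1) := by rw [sub_mul, hHE, mul_add, two_smul]; noncomm_ring
  have h2 : (H - 1) ^ 2 * E = E * (H + 1) ^ 2 := by
    rw [pow_two, pow_two, mul_assoc, h, ← mul_assoc, h, mul_assoc]
  conv_lhs => rw [shiftedCasimir_eq hEF, add_mul, h2]
  rw [shiftedCasimir, mul_add]
  noncomm_ring

include hHF hEF in
lemma commute_shiftedCasimir_F : Commute (shiftedCasimir E F H) F := by
  change shiftedCasimir E F H * F = F * shiftedCasimir E F H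
  have h : (H + 1) * F = F * (H - 1) := by rw [add_mul, hHF, mul_sub, neg_smul, two_smul]; noncomm_ring
  have h2 : (H + 1) ^ 2 * F = F * (H - 1) ^ 2 := by
    rw [pow_two, pow_two, mul_assoc, h, ← mul_assoc, h, mul_assoc]
  conv_rhs => rw [shiftedCasimir_eq hEF, mul_add, ← h2]
  rw [shiftedCasimir, add_mul]
  noncomm_ring

include hHE hEF in
lemma four_pow_mul_pow_mul_pow_succ (k : ℕ) :
    (4 : ℂ) ^ (k + 1) • (F ^ (k + 1) * E ^ (k + 1)) =
      ((4 : ℂ) ^ k • (F ^ k * E ^ k)) * (shiftedCasimir E F H - (H + algebraMap ℂ _ (1 + 2 * (k : ℂ))) ^ 2) := by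
  have h1 : (H + 1) ^ 2 * E ^ k = E ^ k * (H + algebraMap ℂ _ (1 + 2 * (k : ℂ))) ^ 2 := by
    have := sl2_pow_mul hHE k 1
    rw [map_one] at this
    rw [pow_two, pow_two, mul_assoc, this, ← mul_assoc, this, mul_assoc]
  have h2 : (4 : ℂ) • (F * E) = shiftedCasimir E F H - (H + 1) ^ 2 := by
    rw [shiftedCasimir, add_sub_cancel_right, ofNat_smul_eq_nsmul, nsmul_eq_mul]; norm_num
  have h3 := (commute_shiftedCasimir_E hHE hEF).pow_right k
  calc (4 : ℂ) ^ (k + 1) • (F ^ (k + 1) * E ^ (k + 1))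
      = (4 : ℂ) ^ k • (F ^ k * ((4 : ℂ) • (F * E)) * E ^ k) := by
        rw [pow_succ F, pow_succ' E, pow_succ, mul_smul]
        simp only [mul_smul_comm, smul_mul_assoc, mul_assoc]
    _ = _ := by
        rw [h2, mul_assoc, sub_mul, h3.eq, h1, ← mul_sub, smul_mul_assoc, mul_assoc]

include hHE hHF hEF in
lemma four_pow_mul_pow_mul_pow_succ_apply (k : ℕ) {μ ε : ℂ} {x y : V} (hx : H x = μ • x + ε • y)
    (hy : H y = μ • y) :
    ((4 : ℂ) ^ (k + 1) • (F ^ (k + 1) * E ^ (k + 1))) x =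
      shiftedCasimir E F H (((4 : ℂ) ^ k • (F ^ k * E ^ k)) x) -
        ((μ + 1 + 2 * k) ^ 2) • (((4 : ℂ) ^ k • (F ^ k * E ^ k)) x) -
        (2 * ε * (μ + 1 + 2 * k)) • (((4 : ℂ) ^ k • (F ^ k * E ^ k)) y) := by
  have hc : Commute (shiftedCasimir E F H) ((4 : ℂ) ^ k • (F ^ k * E ^ k)) :=
    (((commute_shiftedCasimir_F hHF hEF).pow_right k).mul_right
      ((commute_shiftedCasimir_E hHE hEF).pow_right k)).smul_right _
  rw [four_pow_mul_pow_mul_pow_succ hHE hEF, ← Module.End.mul_apply, hc.eq, Module.End.mul_apply,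
    Module.End.mul_apply, ← map_smul, ← map_smul, ← map_sub, ← map_sub]
  congr 1
  simp only [pow_two, LinearMap.sub_apply, Module.End.mul_apply, LinearMap.add_apply,
    Module.algebraMap_end_apply, hx, hy, map_add, map_smul]
  module

variable {x y : V} (hx : H x = x + y) (hy : H y = y)

open Polynomial in
include hHE hHF hEF hx hy in
lemma four_pow_F_pow_E_pow_apply (k : ℕ) :
    ((4 : ℂ) ^ k • (F ^ k * E ^ k)) x =
      aeval (shiftedCasimir E F H) (casimirPoly k).1 x - aeval (shiftedCasimir E F H) (casimirPoly k).2 y ∧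
    ((4 : ℂ) ^ k • (F ^ k * E ^ k)) y = aeval (shiftedCasimir E F H) (casimirPoly k).1 y := by
  induction k with
  | zero => simp [casimirPoly]
  | succ k ih =>
    rw [four_pow_mul_pow_mul_pow_succ_apply hHE hHF hEF k (x := x) (y := y) (μ := 1) (ε := 1)
        (by simpa using hx) (by simpa using hy),
      four_pow_mul_pow_mul_pow_succ_apply hHE hHF hEF k (x := y) (y := y) (μ := 1) (ε := 0)
        (by simpa using hy) (by simpa using hy), ih.1, ih.2]
    simp only [casimirPoly, mul_comm _ (X - C _), map_mul, map_add, map_sub, aeval_X, aeval_C,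
      LinearMap.add_apply, LinearMap.sub_apply, Module.End.mul_apply, Module.algebraMap_end_apply, map_smul]
    constructor <;> module

open Polynomial in
include hHE hHF hEF hx hy in
lemma four_pow_E_pow_F_pow_apply (k : ℕ) :
    ((4 : ℂ) ^ (k + 1) • (E ^ (k + 1) * F ^ (k + 1))) x =
      aeval (shiftedCasimir E F H) (X * (casimirPoly k).1) x + aeval (shiftedCasimir E F H) (X * (casimirPoly k).2) y ∧
    ((4 : ℂ) ^ (k + 1) • (E ^ (k + 1) * F ^ (k + 1))) y = aeval (shiftedCasimir E F H) (X * (casimirPoly k).1) y := by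
  have hHF' : -H * F = F * -H + (2 : ℂ) • F := by rw [neg_mul, hHF]; simp [add_comm]
  have hHE' : -H * E = E * -H + (-2 : ℂ) • E := by rw [neg_mul, hHE]; simp [add_comm]
  have hEF' : F * E = E * F + -H := by rw [hEF]; abel
  have hΩ : shiftedCasimir F E (-H) = shiftedCasimir E F H := by
    rw [shiftedCasimir_eq hEF, shiftedCasimir]; noncomm_ring
  have step (k : ℕ) := And.intro
    (four_pow_mul_pow_mul_pow_succ_apply hHF' hHE' hEF' k (x := x) (y := y) (μ := -1) (ε := -1)
      (by simp [hx, add_comm]) (by simp [hy]))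
    (four_pow_mul_pow_mul_pow_succ_apply hHF' hHE' hEF' k (x := y) (y := y) (μ := -1) (ε := 0)
      (by simp [hy]) (by simp [hy]))
  simp only [hΩ] at step
  induction k with
  | zero =>
    rw [(step 0).1, (step 0).2]
    simp [casimirPoly]
  | succ k ih =>
    rw [(step (k + 1)).1, (step (k + 1)).2, ih.1, ih.2]
    simp only [casimirPoly, mul_comm _ (X - C _), map_mul, map_add, map_sub, aeval_X, aeval_C,
      LinearMap.add_apply, LinearMap.sub_apply, Module.End.mul_apply, Module.algebraMap_end_apply, map_smul]
    push_cast
    constructor <;> module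

include hHE hHF hEF in
/-- In a finite-dimensional representation of `sl₂`, `H` acts semisimply on the weight `1` space. -/
lemma sl2_weight_one_semisimple [FiniteDimensional ℂ V] {x : V} (hx : (H - 1) ((H - 1) x) = 0) :
    (H - 1) x = 0 := by
  set y := (H - 1) x with hy
  have hx' : (H - algebraMap ℂ _ 1) ((H - algebraMap ℂ _ 1) x) = 0 := by rwa [map_one]
  obtain ⟨k₁, h₁⟩ := exists_pow_apply_eq_zero two_ne_zero hHE hx'
  obtain ⟨k₂, h₂⟩ := exists_pow_apply_eq_zero (neg_ne_zero.2 two_ne_zero) hHF hx'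
  obtain ⟨k₃, h₃⟩ := exists_pow_apply_eq_zero two_ne_zero hHE (x := y) (μ := 1)
    (by rw [map_one, hx, map_zero])
  have hHx : H x = x + y := by rw [hy]; simp
  have hHy : H y = y := by simpa [sub_eq_zero] using hx
  let k := k₁ + k₂ + k₃
  obtain ⟨hTx, hTy⟩ := four_pow_F_pow_E_pow_apply hHE hHF hEF hHx hHy k
  obtain ⟨hSx, -⟩ := four_pow_E_pow_F_pow_apply hHE hHF hEF hHx hHy k
  rw [LinearMap.smul_apply, Module.End.mul_apply, h₁ k (by omega), map_zero, smul_zero] at hTx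
  rw [LinearMap.smul_apply, Module.End.mul_apply, h₃ k (by omega), map_zero, smul_zero] at hTy
  rw [LinearMap.smul_apply, Module.End.mul_apply, h₂ (k + 1) (by omega), map_zero, smul_zero] at hSx
  have hA := sub_eq_zero.1 hTx.symm
  simp only [map_mul, Module.End.mul_apply, hA, ← two_smul ℂ] at hSx
  have hB := (smul_eq_zero_iff_right (two_ne_zero' ℂ)).1 hSx.symm
  obtain ⟨u, v, huv⟩ := isCoprime_casimirPoly k
  have := congrArg (fun p ↦ Polynomial.aeval (shiftedCasimir E F H) p y) huv
  simp only [map_add, map_mul, map_one, LinearMap.add_apply, Module.End.mul_apply, ← hTy, hB,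
    map_zero, zero_add, Module.End.one_apply] at this
  exact this.symm

end Sl2

/-- A finite-dimensional symplectic space has a symplectic basis. -/
lemma exists_symplectic_family {V : Type*} [AddCommGroup V] [Module ℂ V] [FiniteDimensional ℂ V]
    (ω : V →ₗ[ℂ] V →ₗ[ℂ] ℂ) (halt : ∀ x, ω x x = 0) (hnd : ∀ x, (∀ y, ω x y = 0) → x = 0) :
    ∃ (n : ℕ) (p q : Fin n → V), Module.finrank ℂ V = 2 * n ∧
      (∀ i j, ω (p i) (q j) = if i = j then 1 else 0) ∧ (∀ i j, ω (p i) (p j) = 0) ∧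
      (∀ i j, ω (q i) (q j) = 0) ∧ ∀ x, x = ∑ i, (ω x (q i) • p i - ω x (p i) • q i) := by
  have hsk (x y : V) : ω x y = - ω y x := by
    have := halt (x + y)
    simp only [map_add, LinearMap.add_apply, halt] at this
    linear_combination this
  let Q (n : ℕ) : Prop := ∃ p q : Fin n → V,
      (∀ i j, ω (p i) (q j) = if i = j then 1 else 0) ∧ (∀ i j, ω (p i) (p j) = 0) ∧
      (∀ i j, ω (q i) (q j) = 0)
  have hli {n : ℕ} {p q : Fin n → V} (hpq : ∀ i j, ω (p i) (q j) = if i = j then 1 else 0)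
      (hpp : ∀ i j, ω (p i) (p j) = 0) (hqq : ∀ i j, ω (q i) (q j) = 0) :
      LinearIndependent ℂ (Sum.elim p q) := by
    rw [Fintype.linearIndependent_iff]
    intro g hg
    rw [Fintype.sum_sum_type] at hg
    simp only [Sum.elim_inl, Sum.elim_inr] at hg
    rintro (i | i)
    · have := congrArg (fun v ↦ ω v (q i)) hg
      simpa [hpq, hqq] using this
    · have := congrArg (fun v ↦ ω (p i) v) hg
      simpa [hpq, hpp] using this
  have hQ0 : Q 0 := ⟨Fin.elim0, Fin.elim0, fun i ↦ i.elim0, fun i ↦ i.elim0, fun i ↦ i.elim0⟩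
  have hQle (n : ℕ) (h : Q n) : n ≤ Module.finrank ℂ V := by
    obtain ⟨p, q, hpq, hpp, hqq⟩ := h
    have := (hli hpq hpp hqq).fintype_card_le_finrank
    simp at this
    omega
  classical
  obtain ⟨n, ⟨p, q, hpq, hpp, hqq⟩, hmax⟩ : ∃ n, Q n ∧ ¬ Q (n + 1) := by
    by_contra! hcon
    exact absurd (hQle _ (Nat.rec (motive := Q) hQ0 hcon (Module.finrank ℂ V + 1))) (by omega)
  have hqp (i j) : ω (q i) (p j) = if i = j then -1 else 0 := by
    rw [hsk, hpq]; by_cases h : i = j <;> simp [h, eq_comm]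
  let π (x : V) : V := x - ∑ i, (ω x (q i) • p i - ω x (p i) • q i)
  have hπq (x j) : ω (π x) (q j) = 0 := by simp [π, hpq, hqq]
  have hπp (x j) : ω (π x) (p j) = 0 := by simp [π, hqp, hpp]
  have hexp (x : V) : π x = 0 := by
    by_contra hx
    obtain ⟨y, hy⟩ : ∃ y, ω (π x) y ≠ 0 := by
      by_contra! h; exact hx (hnd _ h)
    have hy' : ω (π x) (π y) = ω (π x) y := by
      have : ω (π x) (∑ i, (ω y (q i) • p i - ω y (p i) • q i)) = 0 := by
        simp [-map_sub, LinearMap.map_sub (ω (π x)), hπq x, hπp x]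
      rw [← sub_zero (ω (π x) y), ← this, ← map_sub]
    refine hmax ⟨Fin.cons (π x) p, Fin.cons ((ω (π x) y)⁻¹ • π y) q, ?_, ?_, ?_⟩
    · intro i j
      refine Fin.cases ?_ (fun i ↦ ?_) i <;> refine Fin.cases ?_ (fun j ↦ ?_) j
      · simp [hy', hy]
      · simp [hπq, (Fin.succ_ne_zero _).symm]
      · simp [hsk (p i), hπp, Fin.succ_ne_zero]
      · simp [hpq]
    · intro i j
      refine Fin.cases ?_ (fun i ↦ ?_) i <;> refine Fin.cases ?_ (fun j ↦ ?_) j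
      · simp [halt]
      · simp [hπp]
      · simp [hsk (p i), hπp]
      · simp [hpp]
    · intro i j
      refine Fin.cases ?_ (fun i ↦ ?_) i <;> refine Fin.cases ?_ (fun j ↦ ?_) j
      · simp [halt]
      · simp [hπq]
      · simp [hsk (q i), hπq]
      · simp [hqq]
  have hexp' (x : V) : x = ∑ i, (ω x (q i) • p i - ω x (p i) • q i) := sub_eq_zero.1 (hexp x)
  refine ⟨n, p, q, ?_, hpq, hpp, hqq, hexp'⟩
  have hspan : ⊤ ≤ Submodule.span ℂ (Set.range (Sum.elim p q)) := fun x _ ↦ by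
    rw [hexp' x]
    refine Submodule.sum_mem _ fun i _ ↦ Submodule.sub_mem _ ?_ ?_
    · exact Submodule.smul_mem _ _ (Submodule.subset_span ⟨.inl i, rfl⟩)
    · exact Submodule.smul_mem _ _ (Submodule.subset_span ⟨.inr i, rfl⟩)
  rw [Module.finrank_eq_card_basis (Module.Basis.mk (hli hpq hpp hqq) hspan)]
  simp [two_mul]

section

attribute [local instance] LieRing.ofAssociativeRing

variable {A : Type*} [LieRing A] [LieAlgebra ℂ A] {n : ℕ}

lemma weylAlgebra_commutator_pq (i j : Fin n) :
    RingQuot.mkAlgHom ℂ (WeylRel n) (FreeAlgebra.ι ℂ (Sum.inl i)) *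
        RingQuot.mkAlgHom ℂ (WeylRel n) (FreeAlgebra.ι ℂ (Sum.inr j)) -
      RingQuot.mkAlgHom ℂ (WeylRel n) (FreeAlgebra.ι ℂ (Sum.inr j)) *
        RingQuot.mkAlgHom ℂ (WeylRel n) (FreeAlgebra.ι ℂ (Sum.inl i)) = if i = j then 1 else 0 := by
  have := RingQuot.mkAlgHom_rel ℂ (WeylRel.pq i j)
  rw [map_sub, map_mul, map_mul] at this
  rw [this]
  split_ifs <;> simp

lemma lie_sum_canonical {R ι : Type*} [Ring R] [Algebra ℂ R] [Fintype ι] [DecidableEq ι] (p q : ι → R)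
    (hpq : ∀ i j, p i * q j - q j * p i = if i = j then 1 else 0)
    (hpp : ∀ i j, p i * p j = p j * p i) (hqq : ∀ i j, q i * q j = q j * q i)
    (a b c d : ι → ℂ) (s t : ℂ) :
    ⁅∑ i, (a i • p i - b i • q i) + algebraMap ℂ R s, ∑ i, (c i • p i - d i • q i) + algebraMap ℂ R t⁆
      = algebraMap ℂ R (∑ i, (b i * c i - a i * d i)) := by
  have hs (x : R) : ⁅algebraMap ℂ R s, x⁆ = 0 := by
    rw [Ring.lie_def, Algebra.commutes, sub_self]
  have ht (x : R) : ⁅x, algebraMap ℂ R t⁆ = 0 := by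
    rw [Ring.lie_def, Algebra.commutes, sub_self]
  have hpq' (i j) : ⁅p i, q j⁆ = if i = j then 1 else 0 := hpq i j
  have hqp' (i j) : ⁅q i, p j⁆ = if i = j then -1 else 0 := by
    rw [← lie_skew, hpq']; by_cases h : i = j <;> simp [h, eq_comm]
  have hpp' (i j) : ⁅p i, p j⁆ = 0 := by rw [Ring.lie_def, hpp, sub_self]
  have hqq' (i j) : ⁅q i, q j⁆ = 0 := by rw [Ring.lie_def, hqq, sub_self]
  simp only [add_lie, lie_add, hs, ht, sum_lie, lie_sum, sub_lie, lie_sub, smul_lie, lie_smul,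
    hpq', hqp', hpp', hqq']
  simp [Algebra.algebraMap_eq_smul_one, Finset.sum_smul, smul_smul, sub_smul, Finset.sum_sub_distrib, mul_comm]

lemma mkAlgHom_ι_lie (rel : UniversalEnvelopingAlgebra ℂ A → UniversalEnvelopingAlgebra ℂ A → Prop)
    (x y : A) :
    RingQuot.mkAlgHom ℂ rel (UniversalEnvelopingAlgebra.ι ℂ ⁅x, y⁆) =
      RingQuot.mkAlgHom ℂ rel (UniversalEnvelopingAlgebra.ι ℂ x) *
          RingQuot.mkAlgHom ℂ rel (UniversalEnvelopingAlgebra.ι ℂ y) -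
        RingQuot.mkAlgHom ℂ rel (UniversalEnvelopingAlgebra.ι ℂ y) *
          RingQuot.mkAlgHom ℂ rel (UniversalEnvelopingAlgebra.ι ℂ x) := by
  simp only [LieHom.map_lie, Ring.lie_def, map_sub, map_mul]

/-- Quotients of the enveloping algebra of a Heisenberg-like Lie algebra are Weyl algebras. -/
lemma nonempty_algEquiv_weylAlgebra (V W : Submodule ℂ A) (χ : A →ₗ[ℂ] ℂ) (hVW : ∀ x, x ∈ V ⊔ W)
    (hχV : ∀ v ∈ V, χ v = 0) (hW : ∀ x y : A, ⁅x, y⁆ ∈ W) (hχW : ∀ w ∈ W, ∀ x, χ ⁅w, x⁆ = 0)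
    (p q : Fin n → A) (hp : ∀ i, p i ∈ V) (hq : ∀ i, q i ∈ V)
    (hpq : ∀ i j, χ ⁅p i, q j⁆ = if i = j then 1 else 0) (hpp : ∀ i j, χ ⁅p i, p j⁆ = 0)
    (hqq : ∀ i j, χ ⁅q i, q j⁆ = 0)
    (hexp : ∀ v ∈ V, v = ∑ i, (χ ⁅v, q i⁆ • p i - χ ⁅v, p i⁆ • q i))
    (rel : UniversalEnvelopingAlgebra ℂ A → UniversalEnvelopingAlgebra ℂ A → Prop)
    (hrel : ∀ u v, rel u v ↔ ∃ x ∈ W, u = UniversalEnvelopingAlgebra.ι ℂ x ∧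
      v = algebraMap ℂ (UniversalEnvelopingAlgebra ℂ A) (χ x)) :
    Nonempty (RingQuot rel ≃ₐ[ℂ] WeylAlgebra n) := by
  let φ (x : A) : RingQuot rel := RingQuot.mkAlgHom ℂ rel (UniversalEnvelopingAlgebra.ι ℂ x)
  have hφW (w : A) (hw : w ∈ W) : φ w = algebraMap ℂ _ (χ w) := by
    have := RingQuot.mkAlgHom_rel ℂ ((hrel _ _).2 ⟨w, hw, rfl, rfl⟩)
    rwa [AlgHom.commutes] at this
  have hφlie (x y : A) : φ x * φ y - φ y * φ x = algebraMap ℂ _ (χ ⁅x, y⁆) := by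
    rw [← hφW _ (hW x y)]
    exact (mkAlgHom_ι_lie rel x y).symm
  let P (i : Fin n) : WeylAlgebra n := RingQuot.mkAlgHom ℂ (WeylRel n) (FreeAlgebra.ι ℂ (Sum.inl i))
  let Q (i : Fin n) : WeylAlgebra n := RingQuot.mkAlgHom ℂ (WeylRel n) (FreeAlgebra.ι ℂ (Sum.inr i))
  have hPP (i j) : P i * P j = P j * P i := by
    simpa only [map_mul] using RingQuot.mkAlgHom_rel ℂ (WeylRel.pp i j)
  have hQQ (i j) : Q i * Q j = Q j * Q i := by
    simpa only [map_mul] using RingQuot.mkAlgHom_rel ℂ (WeylRel.qq i j)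
  let ω (y : A) : A →ₗ[ℂ] ℂ := -(χ ∘ₗ (LieAlgebra.ad ℂ A y : A →ₗ[ℂ] A))
  have hω (x y : A) : ω y x = χ ⁅x, y⁆ := by
    simp only [ω, LinearMap.neg_apply, LinearMap.comp_apply, LieAlgebra.ad_apply, ← map_neg, lie_skew]
  let θ : A →ₗ[ℂ] WeylAlgebra n :=
    ∑ i, ((ω (q i)).smulRight (P i) - (ω (p i)).smulRight (Q i)) +
      (Algebra.linearMap ℂ (WeylAlgebra n)) ∘ₗ χ
  have hθ (x : A) : θ x = ∑ i, (χ ⁅x, q i⁆ • P i - χ ⁅x, p i⁆ • Q i) + algebraMap ℂ _ (χ x) := by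
    simp [θ, hω]
  have hθW (w : A) (hw : w ∈ W) : θ w = algebraMap ℂ _ (χ w) := by
    simp [hθ, hχW w hw]
  have hχlie (x y : A) :
      χ ⁅x, y⁆ = ∑ i, (χ ⁅x, p i⁆ * χ ⁅y, q i⁆ - χ ⁅x, q i⁆ * χ ⁅y, p i⁆) := by
    obtain ⟨v, hv, w, hw, rfl⟩ := Submodule.mem_sup.1 (hVW x)
    simp only [add_lie, map_add, hχW w hw, add_zero]
    conv_lhs => rw [hexp v hv]
    simp only [sum_lie, sub_lie, smul_lie, map_sum, map_sub, map_smul, smul_eq_mul]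
    refine Finset.sum_congr rfl fun i _ ↦ ?_
    rw [← lie_skew y, ← lie_skew y, map_neg, map_neg]
    ring
  let Θ : A →ₗ⁅ℂ⁆ WeylAlgebra n :=
    { θ with
      map_lie' := fun {x y} ↦ by
        change θ ⁅x, y⁆ = ⁅θ x, θ y⁆
        rw [hθW _ (hW x y), hθ x, hθ y,
          lie_sum_canonical P Q weylAlgebra_commutator_pq hPP hQQ, hχlie x y] }
  have hΘ (x : A) : Θ x = θ x := rfl
  let F : RingQuot rel →ₐ[ℂ] WeylAlgebra n :=
    RingQuot.liftAlgHom ℂ ⟨UniversalEnvelopingAlgebra.lift ℂ Θ, fun u v huv ↦ by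
      obtain ⟨x, hx, rfl, rfl⟩ := (hrel _ _).1 huv
      rw [UniversalEnvelopingAlgebra.lift_ι_apply, AlgHom.commutes, hΘ, hθW x hx]⟩
  have hF (x : A) : F (φ x) = θ x := by
    simp only [F, φ, RingQuot.liftAlgHom_mkAlgHom_apply, UniversalEnvelopingAlgebra.lift_ι_apply, hΘ]
  let G : WeylAlgebra n →ₐ[ℂ] RingQuot rel :=
    RingQuot.liftAlgHom ℂ ⟨FreeAlgebra.lift ℂ (Sum.elim (fun i ↦ φ (p i)) fun i ↦ φ (q i)), fun u v huv ↦ by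
      cases huv with
      | pq i j =>
        simp only [map_sub, map_mul, FreeAlgebra.lift_ι_apply, Sum.elim_inl, Sum.elim_inr, hφlie, hpq]
        split_ifs <;> simp
      | pp i j =>
        simpa [hpp, sub_eq_zero] using hφlie (p i) (p j)
      | qq i j =>
        simpa [hqq, sub_eq_zero] using hφlie (q i) (q j)⟩
  have hGP (i) : G (P i) = φ (p i) := by
    simp only [G, P, RingQuot.liftAlgHom_mkAlgHom_apply, FreeAlgebra.lift_ι_apply, Sum.elim_inl]
  have hGQ (i) : G (Q i) = φ (q i) := by
    simp only [G, Q, RingQuot.liftAlgHom_mkAlgHom_apply, FreeAlgebra.lift_ι_apply, Sum.elim_inr]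
  refine ⟨AlgEquiv.ofAlgHom F G ?_ ?_⟩
  · refine RingQuot.ringQuot_ext' _ _ _ (FreeAlgebra.hom_ext (funext fun s ↦ ?_))
    rcases s with i | i
    · change F (G (P i)) = P i
      rw [hGP, hF, hθ]
      simp [hpq, hpp, hχV _ (hp i)]
    · change F (G (Q i)) = Q i
      have hqp (j) : χ ⁅q i, p j⁆ = if j = i then -1 else 0 := by
        rw [← lie_skew, map_neg, hpq]; split_ifs <;> simp
      rw [hGQ, hF, hθ]
      simp only [hqp, hqq, hχV _ (hq i), ite_smul, zero_smul, zero_sub, map_zero, add_zero,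
        Finset.sum_neg_distrib, Finset.sum_ite_eq', Finset.mem_univ, if_true]
      module
  · refine RingQuot.ringQuot_ext' _ _ _ (UniversalEnvelopingAlgebra.hom_ext ℂ (LieHom.ext fun x ↦ ?_))
    change G (F (φ x)) = φ x
    let φ' : A →ₗ[ℂ] RingQuot rel :=
      (RingQuot.mkAlgHom ℂ rel).toLinearMap ∘ₗ (UniversalEnvelopingAlgebra.ι ℂ : A →ₗ⁅ℂ⁆ _).toLinearMap
    change G (F (φ' x)) = φ' x
    have hφ' (x : A) : φ' x = φ x := rfl
    obtain ⟨v, hv, w, hw, rfl⟩ := Submodule.mem_sup.1 (hVW x)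
    rw [map_add, map_add, map_add]
    congr 1
    · rw [hφ', hF, hθ, hχV v hv, map_zero, add_zero, ← hφ']
      conv_rhs => rw [hexp v hv]
      simp only [map_sum, map_sub, map_smul, hGP, hGQ]
      simp only [hφ']
    · rw [hφ', hF, hθW w hw, hφW w hw, AlgHom.commutes]

end

section Grading

variable {L : Type*} [LieRing L] [LieAlgebra ℂ L] {h : L}

lemma mem_gwt {j : ℚ} {x : L} : x ∈ gwt h j ↔ ⁅h, x⁆ = ((2 * j : ℚ) : ℂ) • x := by
  rw [gwt, Module.End.mem_eigenspace_iff, LieAlgebra.ad_apply]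

lemma lie_mem_gwt {j k : ℚ} {x y : L} (hx : x ∈ gwt h j) (hy : y ∈ gwt h k) : ⁅x, y⁆ ∈ gwt h (j + k) := by
  rw [mem_gwt] at *
  rw [leibniz_lie, hx, hy, smul_lie, lie_smul, ← add_smul]
  push_cast
  ring_nf

lemma lie_mem_of_mem_iSup_gwt {S T : Set ℚ} {M : Submodule ℂ L}
    (hM : ∀ j ∈ S, ∀ k ∈ T, ∀ a ∈ gwt h j, ∀ b ∈ gwt h k, ⁅a, b⁆ ∈ M) {x y : L}
    (hx : x ∈ ⨆ j ∈ S, gwt h j) (hy : y ∈ ⨆ j ∈ T, gwt h j) : ⁅x, y⁆ ∈ M := by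
  have h1 (j) (hj : j ∈ S) (a) (ha : a ∈ gwt h j) : ⁅a, y⁆ ∈ M := by
    have : ⨆ k ∈ T, gwt h k ≤ M.comap (LieAlgebra.ad ℂ L a : L →ₗ[ℂ] L) :=
      iSup₂_le fun k hk b hb ↦ hM j hj k hk a ha b hb
    exact this hy
  have : ⨆ j ∈ S, gwt h j ≤ M.comap (LieAlgebra.ad ℂ L y : L →ₗ[ℂ] L) := by
    refine iSup₂_le fun j hj a ha ↦ ?_
    rw [Submodule.mem_comap, LieAlgebra.ad_apply, ← lie_skew]
    exact M.neg_mem (h1 j hj a ha)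
  have := this hx
  rw [Submodule.mem_comap, LieAlgebra.ad_apply, ← lie_skew] at this
  exact M.neg_mem_iff.1 this

section Form

variable {B : LinearMap.BilinForm ℂ L} (hinv : ∀ x y z, B ⁅x, y⁆ z = B x ⁅y, z⁆)
include hinv

lemma apply_lie_eq_neg_apply_lie (x y : L) : B ⁅h, x⁆ y = -B x ⁅h, y⁆ := by
  rw [← hinv, ← lie_skew, map_neg, LinearMap.neg_apply]

lemma apply_eq_zero_of_mem_gwt {j k : ℚ} (hjk : j + k ≠ 0) {x y : L} (hx : x ∈ gwt h j)
    (hy : y ∈ gwt h k) : B x y = 0 := by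
  rw [mem_gwt] at *
  have := apply_lie_eq_neg_apply_lie (h := h) hinv x y
  rw [hx, hy, map_smul, map_smul, LinearMap.smul_apply, smul_eq_mul, smul_eq_mul,
    ← add_eq_zero_iff_eq_neg, ← add_mul] at this
  refine (mul_eq_zero.1 this).resolve_left fun h0 ↦ hjk ?_
  have : 2 * j + 2 * k = 0 := by exact_mod_cast h0
  linarith

lemma apply_eq_zero_of_mem_maxGenEigenspace {j : ℚ} {μ : ℂ} (hμ : ((2 * j : ℚ) : ℂ) + μ ≠ 0)
    {x u : L} (hx : x ∈ gwt h j) (hu : u ∈ (LieAlgebra.ad ℂ L h).maxGenEigenspace μ) : B x u = 0 := by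
  rw [mem_gwt] at hx
  have key (k : ℕ) (u : L) : B x (((LieAlgebra.ad ℂ L h - μ • (1 : Module.End ℂ L)) ^ k) u) =
      (-(((2 * j : ℚ) : ℂ) + μ)) ^ k * B x u := by
    induction k generalizing u with
    | zero => simp
    | succ k ih =>
      have := apply_lie_eq_neg_apply_lie (h := h) hinv x u
      rw [hx, map_smul, LinearMap.smul_apply, smul_eq_mul] at this
      rw [pow_succ, Module.End.mul_apply, ih]
      simp only [LinearMap.sub_apply, LinearMap.smul_apply, Module.End.one_apply, map_sub, map_smul,
        LieAlgebra.ad_apply, smul_eq_mul, ← neg_eq_iff_eq_neg.2 this]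
      ring
  obtain ⟨k, hk⟩ := (Module.End.mem_maxGenEigenspace _ _ _).1 hu
  have := key k u
  rw [hk, map_zero] at this
  exact (mul_eq_zero.1 this.symm).resolve_left (pow_ne_zero _ (neg_ne_zero.2 hμ))

end Form

section Triple

variable {e f : L}

lemma isSl2Triple_of_lie_eq (he : ⁅h, e⁆ = (2 : ℂ) • e) (hef : ⁅e, f⁆ = h)
    (hf : ⁅h, f⁆ = (-2 : ℂ) • f) (hh : h ≠ 0) : IsSl2Triple h e f where
  h_ne_zero := hh
  lie_e_f := hef
  lie_h_e_nsmul := by rw [he, ofNat_smul_eq_nsmul]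
  lie_h_f_nsmul := by rw [hf, neg_smul, ofNat_smul_eq_nsmul]

lemma ad_mul_ad_of_lie_eq_smul {c : ℂ} (he : ⁅h, e⁆ = c • e) :
    LieAlgebra.ad ℂ L h * LieAlgebra.ad ℂ L e =
      LieAlgebra.ad ℂ L e * LieAlgebra.ad ℂ L h + c • LieAlgebra.ad ℂ L e := by
  ext x
  simp [leibniz_lie h e x, he, add_comm]

lemma ad_mul_ad_of_lie_eq (hef : ⁅e, f⁆ = h) : LieAlgebra.ad ℂ L e * LieAlgebra.ad ℂ L f =
    LieAlgebra.ad ℂ L f * LieAlgebra.ad ℂ L e + LieAlgebra.ad ℂ L h := by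
  ext x
  simp [leibniz_lie e f x, hef, add_comm]

variable [FiniteDimensional ℂ L] (he : ⁅h, e⁆ = (2 : ℂ) • e) (hef : ⁅e, f⁆ = h)
  (hf : ⁅h, f⁆ = (-2 : ℂ) • f)
include he hef hf

lemma exists_int_of_mem_gwt {j : ℚ} {x : L} (hx : x ∈ gwt h j) (hx0 : x ≠ 0) :
    ∃ n : ℤ, 2 * j = n := by
  have hx' := mem_gwt.1 hx
  by_cases hh : h = 0
  · rw [hh, zero_lie, eq_comm, smul_eq_zero_iff_left hx0] at hx'
    exact ⟨0, by exact_mod_cast hx'⟩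
  have t := isSl2Triple_of_lie_eq he hef hf hh
  have hE := ad_mul_ad_of_lie_eq_smul he
  have hgwt (k : ℕ) : ((LieAlgebra.ad ℂ L e) ^ k) x ∈ gwt h (j + k) := by
    induction k with
    | zero => simpa using hx
    | succ k ih =>
      rw [pow_succ', Module.End.mul_apply, LieAlgebra.ad_apply]
      have he' : e ∈ gwt h 1 := mem_gwt.2 (by simpa using he)
      have := lie_mem_gwt he' ih
      rwa [show 1 + (j + (k : ℚ)) = j + ((k + 1 : ℕ) : ℚ) by push_cast; ring] at this
  obtain ⟨k₀, hk₀⟩ := exists_pow_apply_eq_zero two_ne_zero hE (μ := ((2 * j : ℚ) : ℂ)) (x := x) (by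
    have : (LieAlgebra.ad ℂ L h - algebraMap ℂ _ ((2 * j : ℚ) : ℂ)) x = 0 := by
      rw [LinearMap.sub_apply, Module.algebraMap_end_apply, LieAlgebra.ad_apply, hx', sub_self]
    rw [this, map_zero])
  obtain ⟨k, hk, hk1⟩ := Nat.exists_not_and_succ_of_not_zero_of_exists
    (p := fun k ↦ ((LieAlgebra.ad ℂ L e) ^ k) x = 0) (by simpa using hx0) ⟨k₀, hk₀ k₀ le_rfl⟩
  have P : t.HasPrimitiveVectorWith (((LieAlgebra.ad ℂ L e) ^ k) x) ((2 * (j + k) : ℚ) : ℂ) :=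
    ⟨hk, mem_gwt.1 (hgwt k), by rwa [pow_succ', Module.End.mul_apply, LieAlgebra.ad_apply] at hk1⟩
  obtain ⟨n, hn⟩ := P.exists_nat
  have hn' : 2 * (j + k) = (n : ℚ) := by exact_mod_cast hn
  refine ⟨n - 2 * k, ?_⟩
  push_cast
  linarith

lemma gwt_eq_bot_of_pos_of_lt {j : ℚ} (hj0 : 0 < j) (hj1 : j < 1) (hj : j ≠ 1 / 2) : gwt h j = ⊥ := by
  rw [Submodule.eq_bot_iff]
  intro x hx
  by_contra hx0
  obtain ⟨n, hn⟩ := exists_int_of_mem_gwt he hef hf hx hx0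
  have h0 : (0 : ℚ) < n := by linarith
  have h2 : (n : ℚ) < 2 := by linarith
  have : n = 1 := by
    have : 0 < n := by exact_mod_cast h0
    have : n < 2 := by exact_mod_cast h2
    omega
  subst this
  exact hj (by push_cast at hn; linarith)

lemma eq_zero_of_lie_f_eq_zero {j : ℚ} (hj : 0 < j) {x : L} (hx : x ∈ gwt h j) (hfx : ⁅f, x⁆ = 0) :
    x = 0 := by
  by_contra hx0
  have hx' := mem_gwt.1 hx
  by_cases hh : h = 0
  · rw [hh, zero_lie, eq_comm, smul_eq_zero_iff_left hx0] at hx'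
    have : 2 * j = 0 := by exact_mod_cast hx'
    linarith
  have P : (isSl2Triple_of_lie_eq he hef hf hh).symm.HasPrimitiveVectorWith x (-((2 * j : ℚ) : ℂ)) :=
    ⟨hx0, by rw [neg_lie, hx', neg_smul], hfx⟩
  obtain ⟨n, hn⟩ := P.exists_nat
  have : -(2 * j) = (n : ℚ) := by exact_mod_cast hn
  have := Nat.cast_nonneg (α := ℚ) n
  linarith

lemma maxGenEigenspace_one_le_gwt : (LieAlgebra.ad ℂ L h).maxGenEigenspace 1 ≤ gwt h (1 / 2) := by
  intro u hu
  obtain ⟨k, hk⟩ := (Module.End.mem_maxGenEigenspace _ _ _).1 hu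
  rw [one_smul] at hk
  suffices (LieAlgebra.ad ℂ L h - 1) u = 0 by
    rw [mem_gwt]
    simpa [sub_eq_zero] using this
  clear hu
  induction k generalizing u with
  | zero => simp_all
  | succ k ih =>
    rw [pow_succ, Module.End.mul_apply] at hk
    exact sl2_weight_one_semisimple (ad_mul_ad_of_lie_eq_smul he) (ad_mul_ad_of_lie_eq_smul hf)
      (ad_mul_ad_of_lie_eq hef) (ih hk)

/-- The form `χ(⁅x, y⁆)` is nondegenerate on `g_{1/2}`. -/
lemma eq_zero_of_forall_apply_lie_eq_zero {B : LinearMap.BilinForm ℂ L}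
    (hinv : ∀ x y z, B ⁅x, y⁆ z = B x ⁅y, z⁆) (hnondeg : B.Nondegenerate) {x : L}
    (hx : x ∈ gwt h (1 / 2)) (hxy : ∀ y ∈ gwt h (1 / 2), B f ⁅x, y⁆ = 0) : x = 0 := by
  refine eq_zero_of_lie_f_eq_zero he hef hf (by norm_num) hx (hnondeg.1 _ fun u ↦ ?_)
  have hf' : f ∈ gwt h (-1) := mem_gwt.2 (by simpa using hf)
  have hfx := lie_mem_gwt hf' hx
  have hu : u ∈ ⨆ μ, (LieAlgebra.ad ℂ L h).maxGenEigenspace μ := by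
    rw [Module.End.iSup_maxGenEigenspace_eq_top]; trivial
  have hle : ⨆ μ, (LieAlgebra.ad ℂ L h).maxGenEigenspace μ ≤ LinearMap.ker (B ⁅f, x⁆) := by
    refine iSup_le fun μ v hv ↦ ?_
    rw [LinearMap.mem_ker]
    by_cases hμ : μ = 1
    · subst hμ
      rw [hinv]
      exact hxy v (maxGenEigenspace_one_le_gwt he hef hf hv)
    · refine apply_eq_zero_of_mem_maxGenEigenspace hinv (fun h0 ↦ hμ ?_) hfx hv
      push_cast at h0
      linear_combination h0
  exact hle hu

end Triple

end Grading

/-- With `χ = (f|·)`, the quotient `D = U(g_{>0})/I_{>0,χ}` of the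
universal enveloping algebra of `g_{>0}` by the two-sided ideal generated by
`x - χ(x)`, `x ∈ g_{≥1}`, is isomorphic to the Weyl algebra of rank `dim g_{1/2} / 2`;
in particular the images `φ_i` of elements of `g_{1/2}` satisfy
`[φ_x, φ_y] = χ(⁅x, y⁆)`. -/
theorem stmt4 {L : Type*} [LieRing L] [LieAlgebra ℂ L]
    [FiniteDimensional ℂ L] [LieAlgebra.IsSimple ℂ L]
    (B : LinearMap.BilinForm ℂ L)
    (hsymm : ∀ x y, B x y = B y x)
    (hinv : ∀ x y z, B ⁅x, y⁆ z = B x ⁅y, z⁆)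
    (hnondeg : B.Nondegenerate)
    (e h f : L)
    (he : ⁅h, e⁆ = (2 : ℂ) • e) (hef : ⁅e, f⁆ = h) (hf : ⁅h, f⁆ = (-2 : ℂ) • f)
    -- `P` is the subalgebra `g_{>0}`, `gGE1` is `g_{≥1}`
    (P : LieSubalgebra ℂ L) (hP : P.toSubmodule = ⨆ j ∈ {j : ℚ | 0 < j}, gwt h j)
    (gGE1 : Submodule ℂ L) (hgGE1 : gGE1 = ⨆ j ∈ {j : ℚ | 1 ≤ j}, gwt h j)
    -- the congruence generating the two-sided ideal `I_{>0,χ}`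
    (rel : UniversalEnvelopingAlgebra ℂ ↥P → UniversalEnvelopingAlgebra ℂ ↥P → Prop)
    (hrel : rel = fun u v => ∃ x : ↥P, (x : L) ∈ gGE1 ∧
      u = UniversalEnvelopingAlgebra.ι ℂ x ∧
      v = algebraMap ℂ (UniversalEnvelopingAlgebra ℂ ↥P) (B f (x : L))) :
    Nonempty (RingQuot rel ≃ₐ[ℂ] WeylAlgebra (Module.finrank ℂ ↥(gwt h (1/2)) / 2)) ∧
    ∀ x y : ↥P, (x : L) ∈ gwt h (1/2) → (y : L) ∈ gwt h (1/2) →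
      RingQuot.mkAlgHom ℂ rel (UniversalEnvelopingAlgebra.ι ℂ x) *
          RingQuot.mkAlgHom ℂ rel (UniversalEnvelopingAlgebra.ι ℂ y) -
        RingQuot.mkAlgHom ℂ rel (UniversalEnvelopingAlgebra.ι ℂ y) *
          RingQuot.mkAlgHom ℂ rel (UniversalEnvelopingAlgebra.ι ℂ x) =
      algebraMap ℂ (RingQuot rel) (B f ⁅(x : L), (y : L)⁆) := by
  have hf' : f ∈ gwt h (-1) := mem_gwt.2 (by simpa using hf)
  have hBf {j : ℚ} (hj : j ≠ 1) {x : L} (hx : x ∈ gwt h j) : B f x = 0 :=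
    apply_eq_zero_of_mem_gwt hinv (fun h0 ↦ hj (by linarith)) hf' hx
  have hle (j : ℚ) (hj : 0 < j) : gwt h j ≤ P.toSubmodule :=
    hP ▸ le_iSup₂_of_le (f := fun j (_ : j ∈ {j : ℚ | 0 < j}) ↦ gwt h j) j hj le_rfl
  have hle1 (j : ℚ) (hj : 1 ≤ j) : gwt h j ≤ gGE1 :=
    hgGE1 ▸ le_iSup₂_of_le (f := fun j (_ : j ∈ {j : ℚ | 1 ≤ j}) ↦ gwt h j) j hj le_rfl
  have hbot {j : ℚ} (hj0 : 0 < j) (hj1 : j < 1) (hj : j ≠ 1 / 2) : gwt h j = ⊥ :=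
    gwt_eq_bot_of_pos_of_lt he hef hf hj0 hj1 hj
  have hhalf {j : ℚ} (hj : 0 < j) {a : L} (ha : a ∈ gwt h j) (ha0 : a ≠ 0) : 1 / 2 ≤ j := by
    by_contra! hlt
    exact ha0 (by simpa [hbot hj (by linarith) hlt.ne] using ha)
  have hsup (x : P) : (x : L) ∈ gwt h (1 / 2) ⊔ gGE1 := by
    have hPle : P.toSubmodule ≤ gwt h (1 / 2) ⊔ gGE1 := by
      rw [hP]
      refine iSup₂_le fun j hj ↦ ?_
      by_cases h1 : 1 ≤ j
      · exact (hle1 j h1).trans le_sup_right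
      · by_cases h2 : j = 1 / 2
        · exact h2 ▸ le_sup_left
        · exact hbot hj (not_le.1 h1) h2 ▸ bot_le
    exact hPle x.2
  have hlie (x y : P) : ⁅(x : L), (y : L)⁆ ∈ gGE1 := by
    have hx : (x : L) ∈ P.toSubmodule := x.2
    have hy : (y : L) ∈ P.toSubmodule := y.2
    rw [hP] at hx hy
    refine lie_mem_of_mem_iSup_gwt (fun j hj k hk a ha b hb ↦ ?_) hx hy
    by_cases ha0 : a = 0
    · simp [ha0]
    by_cases hb0 : b = 0
    · simp [hb0]
    exact hle1 _ (by linarith [hhalf hj ha ha0, hhalf hk hb hb0]) (lie_mem_gwt ha hb)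
  have hχ (w x : P) (hw : (w : L) ∈ gGE1) : B f ⁅(w : L), (x : L)⁆ = 0 := by
    have hx : (x : L) ∈ P.toSubmodule := x.2
    rw [hP] at hx
    rw [hgGE1] at hw
    refine LinearMap.mem_ker.1 (lie_mem_of_mem_iSup_gwt (M := LinearMap.ker (B f))
      (fun j (hj : 1 ≤ j) k (hk : 0 < k) a ha b hb ↦ hBf (by linarith) (lie_mem_gwt ha hb)) hw hx)
  subst hrel
  refine ⟨?_, fun x y _ _ ↦ ?_⟩
  · let ω : gwt h (1 / 2) →ₗ[ℂ] gwt h (1 / 2) →ₗ[ℂ] ℂ :=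
      LinearMap.mk₂ ℂ (fun x y ↦ B f ⁅(x : L), (y : L)⁆) (by simp) (by simp) (by simp) (by simp)
    have hω (x y) : ω x y = B f ⁅(x : L), (y : L)⁆ := rfl
    obtain ⟨n, p, q, hn, hpq, hpp, hqq, hexp⟩ := exists_symplectic_family ω (by simp [hω]) fun x hx ↦
      Subtype.ext (eq_zero_of_forall_apply_lie_eq_zero he hef hf hinv hnondeg x.2 fun y hy ↦ hx ⟨y, hy⟩)
    rw [hn, Nat.mul_div_cancel_left n two_pos]
    have hPV (v : gwt h (1 / 2)) : (v : L) ∈ P := hle _ (by norm_num) v.2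
    let ι : P →ₗ[ℂ] L := P.toSubmodule.subtype
    refine nonempty_algEquiv_weylAlgebra ((gwt h (1 / 2)).comap ι) (gGE1.comap ι) (B f ∘ₗ ι) (fun x ↦ ?_)
      (fun v hv ↦ hBf (by norm_num) hv) hlie (fun w hw x ↦ hχ w x hw)
      (fun i ↦ ⟨p i, hPV _⟩) (fun i ↦ ⟨q i, hPV _⟩) (fun i ↦ (p i).2) (fun i ↦ (q i).2) hpq hpp hqq
      (fun v hv ↦ ?_) _ fun u v ↦ Iff.rfl
    · obtain ⟨v, hv, w, hw, hvw⟩ := Submodule.mem_sup.1 (hsup x)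
      have hwP : w ∈ P := by
        rw [← add_sub_cancel_left v w, hvw]
        exact P.sub_mem x.2 (hPV ⟨v, hv⟩)
      exact Submodule.mem_sup.2 ⟨⟨v, hPV ⟨v, hv⟩⟩, hv, ⟨w, hwP⟩, hw, Subtype.ext hvw⟩
    · refine Subtype.ext ?_
      have := congrArg Subtype.val (hexp ⟨v, hv⟩)
      simp only [Submodule.coe_sum, Submodule.coe_sub, Submodule.coe_smul] at this
      refine this.trans (Eq.symm ((map_sum ι _ _).trans ?_))
      simp only [map_sub, map_smul]
      rfl
  · rw [← mkAlgHom_ι_lie, ← AlgHom.commutes (RingQuot.mkAlgHom ℂ _)]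
    exact RingQuot.mkAlgHom_rel ℂ ⟨⁅x, y⁆, hlie x y, rfl, rfl⟩
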